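/- If A has only finitely many objects, then for every k-linear functor S : Aᵒᵖ ⊗ A → Vect_f (finite-dimensional vector spaces), the coend ∫^X S(X,X) exists in Vect_f and is an absolute colimit: the universal cowedge for ∫^X S(X,X) is sent to a universal cowedge by every k-linear functor from Vect_f to any k-linear category. -/

import Mathlib

/-!
Street, "Compact closed functor categories": first Example, first claim.

`k` a field, `A` a `k`-linear category with finite-dimensional hom-spaces and
finitely many objects.  For every `k`-linear functor `S : Aᵒᵖ ⊗ A ⟶ Vect_f`, the
coend `∫^X S(X,X)` exists in `Vect_f` and is absolute: its universal cowedge is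
sent to a universal cowedge by every `k`-linear functor from `Vect_f` to any
`k`-linear category.
-/

open CategoryTheory Opposite

universe w' w v u

namespace AbsoluteCoend

variable {A : Type u} [Category.{v} A]

/-- A cowedge over the data of a "profile" `P` (a bifunctor contravariant in the
first slot, via `l`, covariant in the second, via `r`) with values in a category
`D`: a vertex together with legs `P X X ⟶ pt` satisfying the dinaturality
condition. -/
structure Cowedge {D : Type w} [Category.{w'} D]
    (P : A → A → D)
    (l : ∀ {X X' : A}, (X ⟶ X') → ∀ Y, (P X' Y ⟶ P X Y))
    (r : ∀ (X : A) {Y Y' : A}, (Y ⟶ Y') → (P X Y ⟶ P X Y')) where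
  pt : D
  leg : ∀ X : A, P X X ⟶ pt
  dinat : ∀ {X X' : A} (f : X ⟶ X'), l f X ≫ leg X = r X' f ≫ leg X'

/-- A cowedge is universal (i.e. is the coend `∫^X P X X`) when every cowedge
factors uniquely through it. -/
def IsUniversal {D : Type w} [Category.{w'} D]
    {P : A → A → D}
    {l : ∀ {X X' : A}, (X ⟶ X') → ∀ Y, (P X' Y ⟶ P X Y)}
    {r : ∀ (X : A) {Y Y' : A}, (Y ⟶ Y') → (P X Y ⟶ P X Y')}
    (W : Cowedge P l r) : Prop :=
  ∀ W' : Cowedge P l r, ∃! h : W.pt ⟶ W'.pt, ∀ X : A, W.leg X ≫ h = W'.leg X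

end AbsoluteCoend

open AbsoluteCoend

namespace AbsoluteCoend

open Limits

/-- Let `F` be an additive functor on finite-dimensional vector spaces. A map `φ` that vanishes on
every `F.map (d i)` vanishes on `F.map e` whenever `e` takes values in the sum of the ranges of the
`d i`. -/
theorem map_comp_eq_zero_of_forall_mem_iSup_range
    {k : Type v} [Field k] {D : Type w} [Category.{w'} D] [Preadditive D]
    (F : FGModuleCat.{v} k ⥤ D) [F.Additive]
    {ι : Type*} {U : ι → FGModuleCat.{v} k} {T V : FGModuleCat.{v} k} (d : ∀ i, U i ⟶ V)
    {Z : D} (φ : F.obj V ⟶ Z) (hφ : ∀ i, F.map (d i) ≫ φ = 0)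
    (e : T ⟶ V) (he : ∀ x, e.hom.hom x ∈ ⨆ i, LinearMap.range (d i).hom.hom) :
    F.map e ≫ φ = 0 := by
  have rank_one (c : T →ₗ[k] k) {v : V} (hv : v ∈ ⨆ i, LinearMap.range (d i).hom.hom) :
      F.map (FGModuleCat.ofHom (c.smulRight v)) ≫ φ = 0 := by
    induction hv using Submodule.iSup_induction' with
    | mem i x hx =>
      obtain ⟨y, rfl⟩ := hx
      have : FGModuleCat.ofHom (c.smulRight ((d i).hom.hom y)) =
          FGModuleCat.ofHom (c.smulRight y) ≫ d i := by
        ext t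
        exact ((d i).hom.hom.map_smul (c t) y).symm
      rw [this, F.map_comp, Category.assoc, hφ, comp_zero]
    | zero =>
      have : FGModuleCat.ofHom (c.smulRight (0 : V)) = 0 := by
        ext t
        exact smul_zero (c t)
      rw [this, F.map_zero, zero_comp]
    | add x y _ _ hx hy =>
      have : FGModuleCat.ofHom (c.smulRight (x + y)) =
          FGModuleCat.ofHom (c.smulRight x) + FGModuleCat.ofHom (c.smulRight y) := by
        ext t
        exact smul_add (c t) x y
      rw [this, F.map_add, Preadditive.add_comp, hx, hy, add_zero]
  let b := Module.finBasis k T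
  have sum_rank_one :
      e = ∑ j, FGModuleCat.ofHom ((b.coord j).smulRight (e.hom.hom (b j))) := by
    apply (forget₂ (FGModuleCat k) (ModuleCat k)).map_injective
    rw [Functor.map_sum]
    ext t
    rw [ModuleCat.hom_sum, LinearMap.sum_apply]
    conv_lhs => rw [← b.sum_repr t, map_sum]
    exact Finset.sum_congr rfl fun j _ => e.hom.hom.map_smul _ _
  rw [sum_rank_one, F.map_sum, Preadditive.sum_comp]
  exact Finset.sum_eq_zero fun j _ => rank_one _ (he _)

instance {k : Type v} [Field k] : HasFiniteBiproducts (FGModuleCat.{v} k) :=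
  .of_hasFiniteProducts

/-- The quotient of a finite-dimensional vector space by the sum of the ranges of a family of
maps. -/
abbrev quotientBySup {k : Type v} [Field k] {ι : Type*} {U : ι → FGModuleCat.{v} k}
    {V : FGModuleCat.{v} k} (d : ∀ i, U i ⟶ V) : FGModuleCat.{v} k :=
  FGModuleCat.of k (V ⧸ (⨆ i, LinearMap.range (d i).hom.hom : Submodule k V))

/-- The projection onto the quotient by the sum of the ranges of a family of maps. -/
abbrev quotientBySupπ {k : Type v} [Field k] {ι : Type*} {U : ι → FGModuleCat.{v} k}
    {V : FGModuleCat.{v} k} (d : ∀ i, U i ⟶ V) : V ⟶ quotientBySup d :=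
  FGModuleCat.ofHom (Submodule.mkQ _)

theorem comp_quotientBySupπ {k : Type v} [Field k] {ι : Type*} {U : ι → FGModuleCat.{v} k}
    {V : FGModuleCat.{v} k} (d : ∀ i, U i ⟶ V) (i : ι) : d i ≫ quotientBySupπ d = 0 := by
  ext x
  exact (Submodule.Quotient.mk_eq_zero _).2
    (Submodule.mem_iSup_of_mem (p := fun i => LinearMap.range (d i).hom.hom) i ⟨x, rfl⟩)

/-- The quotient map splits, and the splitting idempotent agrees with the identity modulo the sum
of the ranges. -/
theorem exists_section_quotientBySupπ {k : Type v} [Field k] {ι : Type*}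
    {U : ι → FGModuleCat.{v} k} {V : FGModuleCat.{v} k} (d : ∀ i, U i ⟶ V) :
    ∃ s : quotientBySup d ⟶ V, s ≫ quotientBySupπ d = 𝟙 _ ∧
      ∀ x, (𝟙 V - quotientBySupπ d ≫ s).hom.hom x ∈ ⨆ i, LinearMap.range (d i).hom.hom := by
  let R : Submodule k V := ⨆ i, LinearMap.range (d i).hom.hom
  obtain ⟨s, hs⟩ := R.mkQ.exists_rightInverse_of_surjective R.range_mkQ
  refine ⟨FGModuleCat.ofHom s, congrArg FGModuleCat.ofHom hs, fun x => ?_⟩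
  change x - s (R.mkQ x) ∈ R
  rw [← Submodule.Quotient.mk_eq_zero R, Submodule.Quotient.mk_sub, sub_eq_zero]
  exact (LinearMap.congr_fun hs (R.mkQ x)).symm

/-- The difference of the two canonical maps whose coequalizer is the coend, on the component of
`f : X ⟶ X'`. -/
noncomputable def dinatDifference
    {k : Type v} [Field k] {A : Type u} [Category.{v} A] [Finite A] {P : A → A → FGModuleCat.{v} k}
    (l : ∀ {X X' : A}, (X ⟶ X') → ∀ Y, (P X' Y ⟶ P X Y))
    (r : ∀ (X : A) {Y Y' : A}, (Y ⟶ Y') → (P X Y ⟶ P X Y')) (i : Σ X X' : A, X ⟶ X') :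
    P i.2.1 i.1 ⟶ ⨁ fun X => P X X :=
  l i.2.2 i.1 ≫ biproduct.ι (fun X => P X X) i.1 -
    r i.2.1 i.2.2 ≫ biproduct.ι (fun X => P X X) i.2.1

/-- The quotient of `⨁ X, P X X` by the dinaturality relations. -/
noncomputable def quotientCowedge
    {k : Type v} [Field k] {A : Type u} [Category.{v} A] [Finite A] {P : A → A → FGModuleCat.{v} k}
    (l : ∀ {X X' : A}, (X ⟶ X') → ∀ Y, (P X' Y ⟶ P X Y))
    (r : ∀ (X : A) {Y Y' : A}, (Y ⟶ Y') → (P X Y ⟶ P X Y')) : Cowedge P l r where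
  pt := quotientBySup (dinatDifference l r)
  leg X := biproduct.ι (fun X => P X X) X ≫ quotientBySupπ (dinatDifference l r)
  dinat {X X'} f := by
    have := comp_quotientBySupπ (dinatDifference l r) ⟨X, X', f⟩
    rwa [dinatDifference, Preadditive.sub_comp, sub_eq_zero, Category.assoc, Category.assoc]
      at this

/-- Every additive functor sends the quotient cowedge to a universal cowedge. -/
theorem isUniversal_map_quotientCowedge
    {k : Type v} [Field k] {A : Type u} [Category.{v} A] [Finite A] {P : A → A → FGModuleCat.{v} k}
    (l : ∀ {X X' : A}, (X ⟶ X') → ∀ Y, (P X' Y ⟶ P X Y))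
    (r : ∀ (X : A) {Y Y' : A}, (Y ⟶ Y') → (P X Y ⟶ P X Y'))
    {D : Type w} [Category.{w'} D] [Preadditive D] (F : FGModuleCat.{v} k ⥤ D) [F.Additive] :
    IsUniversal
      (⟨F.obj (quotientCowedge l r).pt, fun X => F.map ((quotientCowedge l r).leg X),
        fun {X X'} f => by rw [← F.map_comp, ← F.map_comp, (quotientCowedge l r).dinat]⟩ :
        Cowedge (fun X Y : A => F.obj (P X Y))
          (fun {X X'} f Y => F.map (l f Y))
          (fun X {Y Y'} f => F.map (r X f))) := by
  classical
  have := Fintype.ofFinite A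
  let ι (X : A) : P X X ⟶ ⨁ fun X => P X X := biproduct.ι (fun X => P X X) X
  let π (X : A) : (⨁ fun X => P X X) ⟶ P X X := biproduct.π (fun X => P X X) X
  let d := dinatDifference l r
  let q := quotientBySupπ d
  obtain ⟨s, hsq, hqs⟩ := exists_section_quotientBySupπ d
  intro W'
  let φ : F.obj (⨁ fun X => P X X) ⟶ W'.pt := ∑ X, F.map (π X) ≫ W'.leg X
  have ι_φ (X : A) : F.map (ι X) ≫ φ = W'.leg X := by
    rw [Preadditive.comp_sum, Finset.sum_eq_single X]
    · rw [← Category.assoc, ← F.map_comp, biproduct.ι_π_self, F.map_id, Category.id_comp]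
    · intro Y _ hY
      rw [← Category.assoc, ← F.map_comp, biproduct.ι_π_ne _ hY.symm, F.map_zero, zero_comp]
    · exact fun h => (h (Finset.mem_univ X)).elim
  have d_φ (i) : F.map (d i) ≫ φ = 0 := by
    change F.map (l i.2.2 i.1 ≫ ι i.1 - r i.2.1 i.2.2 ≫ ι i.2.1) ≫ φ = 0
    rw [F.map_sub, Preadditive.sub_comp, F.map_comp, F.map_comp, Category.assoc, Category.assoc,
      ι_φ, ι_φ, sub_eq_zero]
    exact W'.dinat i.2.2
  have q_s_φ : F.map q ≫ F.map s ≫ φ = φ := by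
    have := map_comp_eq_zero_of_forall_mem_iSup_range F d φ d_φ _ hqs
    rw [F.map_sub, Preadditive.sub_comp, sub_eq_zero, F.map_id, Category.id_comp, F.map_comp,
      Category.assoc] at this
    exact this.symm
  refine ⟨F.map s ≫ φ, fun X => ?_, fun (h : F.obj (quotientBySup d) ⟶ W'.pt) hh => ?_⟩
  · change F.map (ι X ≫ q) ≫ F.map s ≫ φ = W'.leg X
    rw [F.map_comp, Category.assoc, q_s_φ, ι_φ]
  · change ∀ X, F.map (ι X ≫ q) ≫ h = W'.leg X at hh
    change h = F.map s ≫ φ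
    have total : ∑ X, π X ≫ ι X = 𝟙 _ :=
      IsBilimit.total (biproduct.isBilimit fun X => P X X)
    have q_h : F.map q ≫ h = φ := by
      rw [← Category.id_comp q, ← total, Preadditive.sum_comp, F.map_sum, Preadditive.sum_comp]
      exact Finset.sum_congr rfl fun X _ => by
        rw [Category.assoc, F.map_comp, Category.assoc, hh X]
    rw [← q_h, ← Category.assoc, ← F.map_comp, hsq, F.map_id, Category.id_comp]

end AbsoluteCoend

/-- If `A` has finitely many objects, then for every `k`-linear functor
`S : Aᵒᵖ ⊗ A ⟶ Vect_f` the coend `∫^X S(X,X)` exists in `Vect_f` and is an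
absolute colimit: every `k`-linear functor `F` from `Vect_f` to any `k`-linear
category sends the universal cowedge to a universal cowedge. -/
theorem coend_exists_and_absolute_of_finite
    {k : Type v} [Field k]
    {A : Type u} [Category.{v} A] [Preadditive A] [CategoryTheory.Linear k A]
    [∀ X Y : A, FiniteDimensional k (X ⟶ Y)]
    [Finite A]
    (S : Aᵒᵖ ⥤ A ⥤ FGModuleCat.{v} k)
    [S.Additive] [∀ X, (S.obj X).Additive] [∀ X, Functor.Linear k (S.obj X)]
    (hS1 : ∀ {X X' : A} (f : X ⟶ X') (a : k) (Y : A),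
      (S.map (a • f).op).app Y = a • (S.map f.op).app Y) :
    ∃ W : Cowedge (fun X Y : A => (S.obj (op X)).obj Y)
        (fun {X X'} f Y => (S.map f.op).app Y)
        (fun X {Y Y'} f => (S.obj (op X)).map f),
      IsUniversal W ∧
      ∀ (D : Type w) [Category.{w'} D] [Preadditive D]
        [CategoryTheory.Linear k D]
        (F : FGModuleCat.{v} k ⥤ D) [F.Additive] [F.Linear k],
        IsUniversal
          (⟨F.obj W.pt, fun X => F.map (W.leg X),
            fun {X X'} f => by
              rw [← F.map_comp, ← F.map_comp, W.dinat]⟩ :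
            Cowedge (fun X Y : A => F.obj ((S.obj (op X)).obj Y))
              (fun {X X'} f Y => F.map ((S.map f.op).app Y))
              (fun X {Y Y'} f => F.map ((S.obj (op X)).map f))) := by
  exact ⟨quotientCowedge _ _, isUniversal_map_quotientCowedge _ _ (𝟭 _),
    fun D _ _ _ F _ _ => isUniversal_map_quotientCowedge _ _ F⟩
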